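/- arXiv:2204.02223 — 2 statements merged into one kernel-verified Lean document; each statement's English description precedes it below -/
import Mathlib

section
/- Let n ≥ 1 and let 1 < p ≤ 2 ≤ q < ∞. Let m : ℝ^n → ℂ be measurable and suppose K := sup_{ξ ≠ 0} |ξ|^{n(1/p − 1/q)} |m(ξ)| < ∞. Then there exists C ≥ 0 such that ‖𝓕⁻¹(m · 𝓕 f)‖_{L^q(ℝ^n)} ≤ C ‖f‖_{L^p(ℝ^n)} for every Schwartz function f : ℝ^n → ℂ; that is, m is a bounded (L^p, L^q) Fourier multiplier. -/
open MeasureTheory FourierTransform SchwartzMap ENNReal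

section Plancherel
variable {V : Type*} [NormedAddCommGroup V] [InnerProductSpace ℝ V] [FiniteDimensional ℝ V]
  [MeasurableSpace V] [BorelSpace V]

theorem continuous_fourier_of_integrable {f : V → ℂ} (hf : Integrable f) : Continuous (𝓕 f) :=
  VectorFourier.fourierIntegral_continuous Real.continuous_fourierChar continuous_inner hf

theorem enorm_fourier_le_lintegral (f : V → ℂ) (ξ : V) : ‖𝓕 f ξ‖ₑ ≤ ∫⁻ x, ‖f x‖ₑ := by
  rw [Real.fourier_eq]
  refine (enorm_integral_le_lintegral_enorm _).trans (le_of_eq ?_)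
  simp_rw [← ofReal_norm, Circle.norm_smul]

theorem fourier_ae_eq_fourier_toLp {f : V → ℂ} (hf1 : Integrable f) (hf2 : MemLp f 2) :
    𝓕 f =ᵐ[volume] (𝓕 (hf2.toLp f) : Lp ℂ 2 (volume : Measure V)) := by
  apply ae_eq_of_integral_contDiff_smul_eq (continuous_fourier_of_integrable hf1).locallyIntegrable
    ((Lp.memLp _).locallyIntegrable (by norm_num))
  intro g hg hgc
  have hgc' : HasCompactSupport (Complex.ofRealCLM ∘ g) := hgc.comp_left rfl
  have hg' : ContDiff ℝ (⊤ : ℕ∞) (Complex.ofRealCLM ∘ g) :=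
    Complex.ofRealCLM.contDiff.comp hg
  let φ : 𝓢(V, ℂ) := hgc'.toSchwartzMap hg'
  have h := congrArg (fun T => T φ) (Lp.fourier_toTemperedDistribution_eq (hf2.toLp f))
  simp only [TemperedDistribution.fourier_apply, Lp.toTemperedDistribution_apply] at h
  have e1 : ∫ x, (𝓕 φ) x • (hf2.toLp f) x = ∫ x, (𝓕 φ) x • f x :=
    integral_congr_ae (by filter_upwards [hf2.coeFn_toLp] with x hx; rw [hx])
  have e2 : ∫ x, (𝓕 (φ : V → ℂ)) x • f x = ∫ x, φ x • 𝓕 f x :=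
    VectorFourier.integral_bilin_fourierIntegral_eq_flip (.lsmul ℂ ℂ) (L := innerₗ V)
      Real.continuous_fourierChar continuous_inner φ.integrable hf1 |>.trans (by simp [flip_innerₗ]; rfl)
  calc ∫ x, g x • 𝓕 f x = ∫ x, φ x • 𝓕 f x := rfl
    _ = ∫ x, φ x • (𝓕 (hf2.toLp f) : Lp ℂ 2 (volume : Measure V)) x := by
      rw [← e2, ← h, e1]; rfl
    _ = _ := rfl

theorem lintegral_enorm_fourier_sq {f : V → ℂ} (hf1 : Integrable f) (hf2 : MemLp f 2) :
    ∫⁻ ξ, ‖𝓕 f ξ‖ₑ ^ (2 : ℝ) = ∫⁻ x, ‖f x‖ₑ ^ (2 : ℝ) := by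
  have h : eLpNorm (𝓕 f) 2 volume = eLpNorm f 2 volume := by
    rw [eLpNorm_congr_ae (fourier_ae_eq_fourier_toLp hf1 hf2), ← Lp.enorm_def,
      ← eLpNorm_congr_ae hf2.coeFn_toLp, ← Lp.enorm_def, ← ofReal_norm, ← ofReal_norm,
      Lp.norm_fourier_eq]
  rw [eLpNorm_eq_lintegral_rpow_enorm_toReal two_ne_zero ENNReal.ofNat_ne_top,
    eLpNorm_eq_lintegral_rpow_enorm_toReal two_ne_zero ENNReal.ofNat_ne_top] at h
  exact ENNReal.rpow_left_injective (by norm_num) h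

end Plancherel

theorem exists_tsum_int_geometric_le {a : ℝ} (ha : 0 < a) :
    ∃ C : ℝ≥0∞, C ≠ ∞ ∧ ∀ y : ℝ,
      ∑' j : ℤ, (if y ≤ j then ENNReal.ofReal ((2 : ℝ) ^ (-a * j)) else 0) ≤
        C * ENNReal.ofReal ((2 : ℝ) ^ (-a * y)) := by
  refine ⟨∑' i : ℤ, (if 0 ≤ i then ENNReal.ofReal ((2 : ℝ) ^ (-a * i)) else 0), ?_, fun y => ?_⟩
  · have hr : (2 : ℝ) ^ (-a) < 1 := Real.rpow_lt_one_of_one_lt_of_neg (by norm_num) (by linarith)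
    have hs := summable_geometric_of_lt_one (by positivity) hr
    have : ∑' i : ℤ, (if 0 ≤ i then ENNReal.ofReal ((2 : ℝ) ^ (-a * i)) else 0)
        = ∑' k : ℕ, ENNReal.ofReal (((2 : ℝ) ^ (-a)) ^ k) := by
      rw [← (Nat.cast_injective (R := ℤ)).tsum_eq]
      · refine tsum_congr fun k => ?_
        simp [← Real.rpow_natCast, ← Real.rpow_mul]
      · intro i hi
        have : 0 ≤ i := by
          by_contra h
          simp [h] at hi
        exact ⟨i.toNat, by simp [this]⟩
    rw [this]
    exact hs.tsum_ofReal_ne_top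
  · rw [← (Equiv.addRight ⌈y⌉).tsum_eq, ← ENNReal.tsum_mul_right]
    have key : ∀ i : ℤ, (if y ≤ ((i + ⌈y⌉ : ℤ) : ℝ) then
        ENNReal.ofReal ((2 : ℝ) ^ (-a * ((i + ⌈y⌉ : ℤ) : ℝ))) else 0) ≤
        (if 0 ≤ i then ENNReal.ofReal ((2 : ℝ) ^ (-a * i)) else 0) *
          ENNReal.ofReal ((2 : ℝ) ^ (-a * y)) := by
      intro i
      by_cases hi : 0 ≤ i
      · have hle : (2 : ℝ) ^ (-a * ((i + ⌈y⌉ : ℤ) : ℝ)) ≤ 2 ^ (-a * i) * 2 ^ (-a * y) := by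
          rw [← Real.rpow_add (by norm_num)]
          apply Real.rpow_le_rpow_of_exponent_le (by norm_num)
          push_cast
          nlinarith [Int.le_ceil y]
        rw [if_pos hi, ← ENNReal.ofReal_mul (by positivity)]
        split_ifs
        · exact ENNReal.ofReal_le_ofReal hle
        · exact zero_le
      · rw [if_neg, if_neg hi, zero_mul]
        rw [← Int.ceil_le]
        omega
    exact ENNReal.tsum_le_tsum fun i => key i

theorem exists_tsum_le_of_le_two_rpow {a β : ℝ} (ha : 0 < a) (hβ : 0 < β) :
    ∃ C : ℝ≥0∞, C ≠ ∞ ∧ ∀ t : ℝ, 0 < t →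
      ∑' j : ℤ, (if t ≤ (2 : ℝ) ^ (β * j) then ENNReal.ofReal ((2 : ℝ) ^ (-a * j)) else 0) ≤
        C * ENNReal.ofReal (t ^ (-(a / β))) := by
  obtain ⟨C, hC, h⟩ := exists_tsum_int_geometric_le ha
  refine ⟨C, hC, fun t ht => ?_⟩
  have hy : t = (2 : ℝ) ^ (Real.logb 2 t) := (Real.rpow_logb (by norm_num) (by norm_num) ht).symm
  have e : t ^ (-(a / β)) = (2 : ℝ) ^ (-a * (Real.logb 2 t / β)) := by
    conv_lhs => rw [hy]
    rw [← Real.rpow_mul (by norm_num)]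
    congr 1
    ring
  rw [e]
  refine le_trans (le_of_eq (tsum_congr fun j => ?_)) (h (Real.logb 2 t / β))
  congr 1
  rw [← Real.logb_le_iff_le_rpow (by norm_num) ht, div_le_iff₀ hβ, mul_comm]

theorem exists_tsum_le_of_two_rpow_lt {a β : ℝ} (ha : 0 < a) (hβ : 0 < β) :
    ∃ C : ℝ≥0∞, C ≠ ∞ ∧ ∀ t : ℝ, 0 < t →
      ∑' j : ℤ, (if (2 : ℝ) ^ (β * j) < t then ENNReal.ofReal ((2 : ℝ) ^ (a * j)) else 0) ≤
        C * ENNReal.ofReal (t ^ (a / β)) := by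
  obtain ⟨C, hC, h⟩ := exists_tsum_le_of_le_two_rpow ha hβ
  refine ⟨C, hC, fun t ht => ?_⟩
  have h' := h t⁻¹ (inv_pos.2 ht)
  rw [Real.inv_rpow ht.le, Real.rpow_neg ht.le, inv_inv] at h'
  refine le_trans ?_ h'
  rw [← (Equiv.neg ℤ).tsum_eq]
  refine ENNReal.tsum_le_tsum fun j => ?_
  have key : (if (2 : ℝ) ^ (β * ((-j : ℤ) : ℝ)) < t then
      ENNReal.ofReal ((2 : ℝ) ^ (a * ((-j : ℤ) : ℝ))) else 0) ≤
      (if t⁻¹ ≤ (2 : ℝ) ^ (β * j) then ENNReal.ofReal ((2 : ℝ) ^ (-a * j)) else 0) := by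
    push_cast
    split_ifs with h1 h2
    · simp
    · refine absurd ?_ h2
      rw [mul_neg, Real.rpow_neg (by norm_num)] at h1
      exact (inv_lt_of_inv_lt₀ (by positivity) h1).le
    · exact zero_le
    · exact le_rfl
  exact key

section WeightedPlancherel
variable {V : Type*} [NormedAddCommGroup V] [InnerProductSpace ℝ V] [FiniteDimensional ℝ V]
  [MeasurableSpace V] [BorelSpace V]

theorem setLIntegral_enorm_fourier_sq_le {f : V → ℂ} (hfm : Measurable f) (hf1 : Integrable f)
    (hf2 : MemLp f 2) (s : Set V) (c : ℝ) :
    ∫⁻ ξ in s, ‖𝓕 f ξ‖ₑ ^ (2 : ℝ) ≤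
      2 * (∫⁻ x, if ‖f x‖ ≤ c then ‖f x‖ₑ ^ (2 : ℝ) else 0) +
        2 * volume s * (∫⁻ x, if c < ‖f x‖ then ‖f x‖ₑ else 0) ^ (2 : ℝ) := by
  set S : Set V := {x | ‖f x‖ ≤ c} with hS
  have hSm : MeasurableSet S := measurableSet_le hfm.norm measurable_const
  set g := S.indicator f
  set b := Sᶜ.indicator f
  have hg1 : Integrable g := hf1.indicator hSm
  have hb1 : Integrable b := hf1.indicator hSm.compl
  have hg2 : MemLp g 2 := hf2.indicator hSm
  have hfgb : f = g + b := (Set.indicator_self_add_compl S f).symm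
  have hF : 𝓕 f = 𝓕 g + 𝓕 b := by
    conv_lhs => rw [hfgb]
    exact VectorFourier.fourierIntegral_add Real.continuous_fourierChar continuous_inner hg1 hb1
  have hg : ∫⁻ x, ‖g x‖ₑ ^ (2 : ℝ) = ∫⁻ x, if ‖f x‖ ≤ c then ‖f x‖ₑ ^ (2 : ℝ) else 0 := by
    refine lintegral_congr fun x => ?_
    by_cases hx : ‖f x‖ ≤ c
    · simp [g, S, hx]
    · simp [g, S, hx]
  have hb : ∫⁻ x, ‖b x‖ₑ = ∫⁻ x, if c < ‖f x‖ then ‖f x‖ₑ else 0 := by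
    refine lintegral_congr fun x => ?_
    by_cases hx : ‖f x‖ ≤ c
    · simp [b, S, hx]
    · simp [b, S, hx, not_le.1 hx]
  rw [← hg, ← hb, ← lintegral_enorm_fourier_sq hg1 hg2]
  have hm : Measurable fun ξ => ‖𝓕 g ξ‖ₑ ^ (2 : ℝ) :=
    ((continuous_fourier_of_integrable hg1).measurable.enorm).pow_const _
  calc ∫⁻ ξ in s, ‖𝓕 f ξ‖ₑ ^ (2 : ℝ)
      ≤ ∫⁻ ξ in s, (2 * ‖𝓕 g ξ‖ₑ ^ (2 : ℝ) + 2 * (∫⁻ x, ‖b x‖ₑ) ^ (2 : ℝ)) := by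
        refine lintegral_mono fun ξ => ?_
        calc ‖𝓕 f ξ‖ₑ ^ (2 : ℝ) ≤ (‖𝓕 g ξ‖ₑ + ∫⁻ x, ‖b x‖ₑ) ^ (2 : ℝ) := by
              gcongr
              rw [hF]
              exact (enorm_add_le _ _).trans (by gcongr; exact enorm_fourier_le_lintegral b ξ)
          _ ≤ _ := by
              refine (ENNReal.rpow_add_le_mul_rpow_add_rpow _ _ (by norm_num)).trans ?_
              norm_num [mul_add]
    _ = 2 * (∫⁻ ξ in s, ‖𝓕 g ξ‖ₑ ^ (2 : ℝ)) + 2 * volume s * (∫⁻ x, ‖b x‖ₑ) ^ (2 : ℝ) := by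
        rw [lintegral_add_left (hm.const_mul _), lintegral_const_mul _ hm, setLIntegral_const]
        ring
    _ ≤ _ := by gcongr; exact Measure.restrict_le_self

theorem exists_lintegral_weight_fourier_sq_le_of_le_one [Nontrivial V] {p : ℝ} (hp1 : 1 < p)
    (hp2 : p < 2) :
    ∃ C : ℝ≥0∞, C ≠ ∞ ∧ ∀ f : V → ℂ, Measurable f → Integrable f → MemLp f 2 →
      ∫⁻ x, ‖f x‖ₑ ^ p ≤ 1 →
      ∫⁻ ξ, ENNReal.ofReal (‖ξ‖ ^ (-(Module.finrank ℝ V * (2 / p - 1)))) *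
        ‖𝓕 f ξ‖ₑ ^ (2 : ℝ) ≤ C := by
  set d : ℝ := ((Module.finrank ℝ V : ℕ) : ℝ) with hd
  have hd0 : 0 < d := by rw [hd]; exact_mod_cast Module.finrank_pos
  have hp0 : 0 < p := by linarith
  set γ := d * (2 / p - 1) with hγ
  have hγ0 : 0 < γ := mul_pos hd0 (by rw [sub_pos, lt_div_iff₀ hp0]; linarith)
  set δ := d * (1 - 1 / p) with hδ
  have hδ0 : 0 < δ := mul_pos hd0 (by rw [sub_pos, div_lt_iff₀ hp0]; linarith)
  have hβ0 : 0 < d / p := div_pos hd0 hp0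
  obtain ⟨C₁, hC₁, h₁⟩ := exists_tsum_le_of_le_two_rpow hγ0 hβ0
  obtain ⟨C₂, hC₂, h₂⟩ := exists_tsum_le_of_two_rpow_lt hδ0 hβ0
  set κ : ℝ≥0∞ := volume (Metric.ball (0 : V) 1)
  have hκ : κ ≠ ∞ := measure_ball_lt_top.ne
  refine ⟨2 * C₁ + 2 * (ENNReal.ofReal (2 ^ d) * κ) * C₂, by finiteness, ?_⟩
  intro f hfm hf1 hf2 hfp
  -- sums over dyadic scales, pointwise in `x`
  have e₁ : ∀ x, ∑' j : ℤ, ENNReal.ofReal ((2 : ℝ) ^ (-γ * j)) *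
      (if ‖f x‖ ≤ (2 : ℝ) ^ (d / p * j) then ‖f x‖ₑ ^ (2 : ℝ) else 0) ≤ C₁ * ‖f x‖ₑ ^ p := by
    intro x
    rcases (norm_nonneg (f x)).eq_or_lt with h0 | h0
    · have : f x = 0 := norm_eq_zero.1 h0.symm
      simp [this]
    · calc _ = (∑' j : ℤ, (if ‖f x‖ ≤ (2 : ℝ) ^ (d / p * j) then
              ENNReal.ofReal ((2 : ℝ) ^ (-γ * j)) else 0)) * ‖f x‖ₑ ^ (2 : ℝ) := by
            rw [← ENNReal.tsum_mul_right]
            exact tsum_congr fun j => by split_ifs <;> simp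
        _ ≤ C₁ * ENNReal.ofReal (‖f x‖ ^ (-(γ / (d / p)))) * ‖f x‖ₑ ^ (2 : ℝ) := by
            gcongr; exact h₁ _ h0
        _ = C₁ * ‖f x‖ₑ ^ p := by
            rw [mul_assoc, ← ofReal_norm, ENNReal.ofReal_rpow_of_pos h0,
              ENNReal.ofReal_rpow_of_pos h0, ← ENNReal.ofReal_mul (by positivity),
              ← Real.rpow_add h0]
            congr 3
            rw [hγ]
            field_simp
            ring
  have e₂ : ∀ x, ∑' j : ℤ, ENNReal.ofReal ((2 : ℝ) ^ (δ * j)) *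
      (if (2 : ℝ) ^ (d / p * j) < ‖f x‖ then ‖f x‖ₑ else 0) ≤ C₂ * ‖f x‖ₑ ^ p := by
    intro x
    rcases (norm_nonneg (f x)).eq_or_lt with h0 | h0
    · have : f x = 0 := norm_eq_zero.1 h0.symm
      simp [this]
    · calc _ = (∑' j : ℤ, (if (2 : ℝ) ^ (d / p * j) < ‖f x‖ then
              ENNReal.ofReal ((2 : ℝ) ^ (δ * j)) else 0)) * ‖f x‖ₑ := by
            rw [← ENNReal.tsum_mul_right]
            exact tsum_congr fun j => by split_ifs <;> simp
        _ ≤ C₂ * ENNReal.ofReal (‖f x‖ ^ (δ / (d / p))) * ‖f x‖ₑ := by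
            gcongr; exact h₂ _ h0
        _ = C₂ * ‖f x‖ₑ ^ p := by
            rw [mul_assoc, ← ofReal_norm, ENNReal.ofReal_rpow_of_pos h0,
              ← ENNReal.ofReal_mul (by positivity), ← Real.rpow_add_one h0.ne']
            congr 3
            rw [hδ]
            field_simp
            ring
  -- the estimate on one dyadic annulus
  let A : ℤ → Set V := fun j => {ξ | (2 : ℝ) ^ (j : ℝ) ≤ ‖ξ‖ ∧ ‖ξ‖ < 2 ^ ((j : ℝ) + 1)}
  have hA : ∀ j, ∫⁻ ξ in A j, ENNReal.ofReal (‖ξ‖ ^ (-γ)) * ‖𝓕 f ξ‖ₑ ^ (2 : ℝ) ≤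
      2 * (ENNReal.ofReal ((2 : ℝ) ^ (-γ * j)) *
        ∫⁻ x, if ‖f x‖ ≤ (2 : ℝ) ^ (d / p * j) then ‖f x‖ₑ ^ (2 : ℝ) else 0) +
      2 * (ENNReal.ofReal (2 ^ d) * κ) * (ENNReal.ofReal ((2 : ℝ) ^ (δ * j)) *
        ∫⁻ x, if (2 : ℝ) ^ (d / p * j) < ‖f x‖ then ‖f x‖ₑ else 0) := by
    intro j
    set lam : ℝ := (2 : ℝ) ^ (d / p * j)
    have hlam : 0 < lam := by positivity
    set G := ∫⁻ x, if ‖f x‖ ≤ lam then ‖f x‖ₑ ^ (2 : ℝ) else 0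
    set B := ∫⁻ x, if lam < ‖f x‖ then ‖f x‖ₑ else 0
    have hAm : MeasurableSet (A j) :=
      (measurableSet_le measurable_const measurable_norm).inter
        (measurableSet_lt measurable_norm measurable_const)
    have hvol : volume (A j) ≤ ENNReal.ofReal (2 ^ (((j : ℝ) + 1) * d)) * κ := by
      refine (measure_mono (t := Metric.ball 0 (2 ^ ((j : ℝ) + 1))) ?_).trans_eq ?_
      · intro ξ hξ
        simpa using hξ.2
      · rw [Measure.addHaar_ball _ _ (by positivity), ← Real.rpow_natCast,
          ← Real.rpow_mul (by norm_num)]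
    have hB : B ≤ ENNReal.ofReal (lam ^ (1 - p)) := by
      calc B ≤ ∫⁻ x, ENNReal.ofReal (lam ^ (1 - p)) * ‖f x‖ₑ ^ p := by
            refine lintegral_mono fun x => ?_
            split_ifs with hx
            · have hx0 : 0 < ‖f x‖ := hlam.trans hx
              rw [← ofReal_norm, ENNReal.ofReal_rpow_of_pos hx0,
                ← ENNReal.ofReal_mul (by positivity)]
              apply ENNReal.ofReal_le_ofReal
              calc ‖f x‖ = ‖f x‖ ^ (1 - p) * ‖f x‖ ^ p := by
                    rw [← Real.rpow_add hx0]; simp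
                _ ≤ _ := by
                    gcongr ?_ * _
                    exact Real.rpow_le_rpow_of_nonpos hlam hx.le (by linarith)
            · exact zero_le
        _ = ENNReal.ofReal (lam ^ (1 - p)) * ∫⁻ x, ‖f x‖ₑ ^ p :=
            lintegral_const_mul _ (hfm.enorm.pow_const _)
        _ ≤ _ := mul_le_of_le_one_right' hfp
    calc ∫⁻ ξ in A j, ENNReal.ofReal (‖ξ‖ ^ (-γ)) * ‖𝓕 f ξ‖ₑ ^ (2 : ℝ)
        ≤ ∫⁻ ξ in A j, ENNReal.ofReal ((2 : ℝ) ^ (-γ * j)) * ‖𝓕 f ξ‖ₑ ^ (2 : ℝ) := by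
          refine setLIntegral_mono' hAm fun ξ hξ => ?_
          gcongr
          rw [mul_comm, Real.rpow_mul (by norm_num)]
          exact Real.rpow_le_rpow_of_nonpos (by positivity) hξ.1 (by linarith)
      _ = ENNReal.ofReal ((2 : ℝ) ^ (-γ * j)) * ∫⁻ ξ in A j, ‖𝓕 f ξ‖ₑ ^ (2 : ℝ) :=
          lintegral_const_mul _
            (((continuous_fourier_of_integrable hf1).measurable.enorm).pow_const _)
      _ ≤ ENNReal.ofReal ((2 : ℝ) ^ (-γ * j)) * (2 * G +
            2 * (ENNReal.ofReal (2 ^ (((j : ℝ) + 1) * d)) * κ) *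
              (ENNReal.ofReal (lam ^ (1 - p)) * B)) := by
          gcongr
          refine (setLIntegral_enorm_fourier_sq_le hfm hf1 hf2 (A j) lam).trans ?_
          rw [ENNReal.rpow_two, sq]
          gcongr
      _ = 2 * (ENNReal.ofReal ((2 : ℝ) ^ (-γ * j)) * G) + 2 * κ * B *
            (ENNReal.ofReal ((2 : ℝ) ^ (-γ * j)) * ENNReal.ofReal (2 ^ (((j : ℝ) + 1) * d)) *
              ENNReal.ofReal (lam ^ (1 - p))) := by ring
      _ = 2 * (ENNReal.ofReal ((2 : ℝ) ^ (-γ * j)) * G) + 2 * κ * B *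
            (ENNReal.ofReal (2 ^ d) * ENNReal.ofReal ((2 : ℝ) ^ (δ * j))) := by
          congr 2
          rw [← ENNReal.ofReal_mul (by positivity), ← ENNReal.ofReal_mul (by positivity),
            ← ENNReal.ofReal_mul (by positivity)]
          congr 1
          simp only [lam]
          rw [← Real.rpow_mul (by norm_num), ← Real.rpow_add (by norm_num),
            ← Real.rpow_add (by norm_num), ← Real.rpow_add (by norm_num)]
          congr 1
          rw [hγ, hδ]
          field_simp
          ring
      _ = _ := by ring
  -- the annuli cover all nonzero frequencies
  have hcover : ({0}ᶜ : Set V) ⊆ ⋃ j, A j := by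
    intro ξ hξ
    have h0 : 0 < ‖ξ‖ := norm_pos_iff.2 hξ
    refine Set.mem_iUnion.2 ⟨⌊Real.logb 2 ‖ξ‖⌋, ?_, ?_⟩
    · rw [← Real.le_logb_iff_rpow_le (by norm_num) h0]
      exact Int.floor_le _
    · rw [← Real.logb_lt_iff_lt_rpow (by norm_num) h0]
      exact Int.lt_floor_add_one _
  have hm₁ : ∀ j : ℤ, Measurable fun x =>
      if ‖f x‖ ≤ (2 : ℝ) ^ (d / p * j) then ‖f x‖ₑ ^ (2 : ℝ) else 0 := fun j =>
    (hfm.enorm.pow_const _).ite (measurableSet_le hfm.norm measurable_const) measurable_const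
  have hm₂ : ∀ j : ℤ, Measurable fun x =>
      if (2 : ℝ) ^ (d / p * j) < ‖f x‖ then ‖f x‖ₑ else 0 := fun j =>
    hfm.enorm.ite (measurableSet_lt measurable_const hfm.norm) measurable_const
  calc ∫⁻ ξ, ENNReal.ofReal (‖ξ‖ ^ (-γ)) * ‖𝓕 f ξ‖ₑ ^ (2 : ℝ)
      = ∫⁻ ξ in {0}ᶜ, ENNReal.ofReal (‖ξ‖ ^ (-γ)) * ‖𝓕 f ξ‖ₑ ^ (2 : ℝ) := by
        rw [restrict_compl_singleton]
    _ ≤ ∫⁻ ξ in ⋃ j, A j, ENNReal.ofReal (‖ξ‖ ^ (-γ)) * ‖𝓕 f ξ‖ₑ ^ (2 : ℝ) :=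
        lintegral_mono_set hcover
    _ ≤ ∑' j, ∫⁻ ξ in A j, ENNReal.ofReal (‖ξ‖ ^ (-γ)) * ‖𝓕 f ξ‖ₑ ^ (2 : ℝ) :=
        lintegral_iUnion_le _ _
    _ ≤ _ := ENNReal.tsum_le_tsum hA
    _ = 2 * (∫⁻ x, ∑' j : ℤ, ENNReal.ofReal ((2 : ℝ) ^ (-γ * j)) *
          (if ‖f x‖ ≤ (2 : ℝ) ^ (d / p * j) then ‖f x‖ₑ ^ (2 : ℝ) else 0)) +
        2 * (ENNReal.ofReal (2 ^ d) * κ) * (∫⁻ x, ∑' j : ℤ, ENNReal.ofReal ((2 : ℝ) ^ (δ * j)) *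
          (if (2 : ℝ) ^ (d / p * j) < ‖f x‖ then ‖f x‖ₑ else 0)) := by
        rw [ENNReal.tsum_add, ENNReal.tsum_mul_left, ENNReal.tsum_mul_left,
          lintegral_tsum fun j => ((hm₁ j).const_mul _).aemeasurable,
          lintegral_tsum fun j => ((hm₂ j).const_mul _).aemeasurable]
        simp_rw [lintegral_const_mul _ (hm₁ _), lintegral_const_mul _ (hm₂ _)]
    _ ≤ 2 * (∫⁻ x, C₁ * ‖f x‖ₑ ^ p) +
        2 * (ENNReal.ofReal (2 ^ d) * κ) * (∫⁻ x, C₂ * ‖f x‖ₑ ^ p) := by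
        gcongr with x x
        · exact e₁ x
        · exact e₂ x
    _ = 2 * C₁ * (∫⁻ x, ‖f x‖ₑ ^ p) +
        2 * (ENNReal.ofReal (2 ^ d) * κ) * C₂ * (∫⁻ x, ‖f x‖ₑ ^ p) := by
        rw [lintegral_const_mul _ (hfm.enorm.pow_const _),
          lintegral_const_mul _ (hfm.enorm.pow_const _)]
        ring
    _ ≤ _ := add_le_add (mul_le_of_le_one_right' hfp) (mul_le_of_le_one_right' hfp)

theorem exists_lintegral_weight_fourier_sq_le [Nontrivial V] {p : ℝ} (hp1 : 1 < p) (hp2 : p ≤ 2) :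
    ∃ C : ℝ≥0∞, C ≠ ∞ ∧ ∀ f : V → ℂ, Measurable f → Integrable f → MemLp f 2 →
      ∫⁻ ξ, ENNReal.ofReal (‖ξ‖ ^ (-(Module.finrank ℝ V * (2 / p - 1)))) *
        ‖𝓕 f ξ‖ₑ ^ (2 : ℝ) ≤ C * (∫⁻ x, ‖f x‖ₑ ^ p) ^ (2 / p) := by
  have hp0 : 0 < p := by linarith
  rcases hp2.eq_or_lt with rfl | hp2
  · refine ⟨1, ENNReal.one_ne_top, fun f _ hf1 hf2 => ?_⟩
    simpa using (lintegral_enorm_fourier_sq hf1 hf2).le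
  obtain ⟨C, hC, h⟩ := exists_lintegral_weight_fourier_sq_le_of_le_one (V := V) hp1 hp2
  refine ⟨C + 1, by finiteness, fun f hfm hf1 hf2 => ?_⟩
  set I := ∫⁻ x, ‖f x‖ₑ ^ p with hI
  by_cases hI0 : I = 0
  · have hf0 : ∫⁻ x, ‖f x‖ₑ = 0 := by
      rw [lintegral_eq_zero_iff (hfm.enorm.pow_const _)] at hI0
      rw [lintegral_eq_zero_iff hfm.enorm]
      filter_upwards [hI0] with x hx
      simpa [hp0, hp0.not_gt] using hx
    have hF : ∀ ξ, ‖𝓕 f ξ‖ₑ = 0 := fun ξ =>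
      le_antisymm ((enorm_fourier_le_lintegral f ξ).trans_eq hf0) zero_le
    simp [hF]
  by_cases hItop : I = ∞
  · simp [hItop, hp0]
  set N : ℝ := (I ^ (1 / p)).toReal
  have hNI : ENNReal.ofReal N = I ^ (1 / p) :=
    ENNReal.ofReal_toReal (ENNReal.rpow_ne_top_of_nonneg (by positivity) hItop)
  have hN0 : 0 < N := ENNReal.toReal_pos
    (by simp [ENNReal.rpow_eq_zero_iff, hI0, hItop])
    (ENNReal.rpow_ne_top_of_nonneg (by positivity) hItop)
  have hNe : ‖(N : ℂ)‖ₑ = I ^ (1 / p) := by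
    rw [← ofReal_norm, Complex.norm_real, Real.norm_of_nonneg hN0.le, hNI]
  have hNC : (N : ℂ) ≠ 0 := by exact_mod_cast hN0.ne'
  set g : V → ℂ := (N : ℂ)⁻¹ • f
  have hfg : f = (N : ℂ) • g := by simp [g, smul_smul, hNC]
  have hg : ∀ x, ‖f x‖ₑ = I ^ (1 / p) * ‖g x‖ₑ := by
    intro x
    conv_lhs => rw [hfg]
    rw [Pi.smul_apply, smul_eq_mul, enorm_mul, hNe]
  have hF : ∀ ξ, ‖𝓕 f ξ‖ₑ = I ^ (1 / p) * ‖𝓕 g ξ‖ₑ := by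
    intro ξ
    have : 𝓕 f = (N : ℂ) • 𝓕 g := by
      conv_lhs => rw [hfg]
      exact VectorFourier.fourierIntegral_const_smul _ _ _ _ _
    rw [this, Pi.smul_apply, smul_eq_mul, enorm_mul, hNe]
  have hgm : Measurable g := hfm.const_smul _
  have hg1 : Integrable g := hf1.smul _
  have hIp : (I ^ (1 / p)) ^ p = I := by
    rw [← ENNReal.rpow_mul, one_div_mul_cancel hp0.ne', ENNReal.rpow_one]
  have hgp : ∫⁻ x, ‖g x‖ₑ ^ p ≤ 1 := by
    have : I = I * ∫⁻ x, ‖g x‖ₑ ^ p := by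
      conv_lhs => rw [hI]
      simp_rw [hg, ENNReal.mul_rpow_of_nonneg _ _ hp0.le, hIp]
      rw [lintegral_const_mul _ (hgm.enorm.pow_const _)]
    exact ((ENNReal.mul_right_inj hI0 hItop).1 (this.symm.trans (mul_one I).symm)).le
  have hm : Measurable fun ξ : V =>
      ENNReal.ofReal (‖ξ‖ ^ (-(Module.finrank ℝ V * (2 / p - 1)))) * ‖𝓕 g ξ‖ₑ ^ (2 : ℝ) :=
    (measurable_norm.pow_const _).ennreal_ofReal.mul
      ((continuous_fourier_of_integrable hg1).measurable.enorm.pow_const _)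
  calc _ = ∫⁻ ξ, I ^ (2 / p) * (ENNReal.ofReal
        (‖ξ‖ ^ (-(Module.finrank ℝ V * (2 / p - 1)))) * ‖𝓕 g ξ‖ₑ ^ (2 : ℝ)) := by
        refine lintegral_congr fun ξ => ?_
        rw [hF, ENNReal.mul_rpow_of_nonneg _ _ (by norm_num), ← ENNReal.rpow_mul,
          one_div_mul_eq_div]
        ring
    _ ≤ I ^ (2 / p) * C := by
        rw [lintegral_const_mul _ hm]
        gcongr
        exact h g hgm hg1 (hf2.const_smul _) hgp
    _ ≤ _ := by
        rw [mul_comm]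
        gcongr
        exact le_self_add

end WeightedPlancherel

theorem lintegral_enorm_rpow_le_of_duality {V : Type*} [NormedAddCommGroup V] [ProperSpace V]
    [MeasurableSpace V] [BorelSpace V] {μ : Measure V} [IsFiniteMeasureOnCompacts μ]
    {q r : ℝ} (hqr : q.HolderConjugate r) (hq : 2 ≤ q) {u : V → ℂ} (hu : Continuous u) {A : ℝ≥0∞}
    (h : ∀ φ : V → ℂ, Measurable φ → Integrable φ μ → MemLp φ 2 μ →
      ‖∫ x, u x * φ x ∂μ‖ₑ ≤ A * (∫⁻ x, ‖φ x‖ₑ ^ r ∂μ) ^ (1 / r)) :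
    (∫⁻ x, ‖u x‖ₑ ^ q ∂μ) ^ (1 / q) ≤ A := by
  have hq0 : 0 < q := by linarith
  have key : ∀ k : ℕ, (∫⁻ x in Metric.closedBall 0 (k : ℝ), ‖u x‖ₑ ^ q ∂μ) ≤ A ^ q := by
    intro k
    set B : Set V := Metric.closedBall 0 (k : ℝ)
    have hB : IsCompact B := isCompact_closedBall _ _
    have hBm : MeasurableSet B := hB.measurableSet
    have : IsFiniteMeasure (μ.restrict B) := ⟨by simpa using hB.measure_lt_top⟩
    set v : V → ℂ := fun x => starRingEnd ℂ (u x) * ((‖u x‖ ^ (q - 2) : ℝ) : ℂ)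
    have hv : Continuous v := (Complex.continuous_conj.comp hu).mul
      (Complex.continuous_ofReal.comp (hu.norm.rpow_const fun _ => Or.inr (by linarith)))
    have hvn : ∀ x, ‖v x‖ = ‖u x‖ ^ (q - 1) := by
      intro x
      rw [norm_mul, RCLike.norm_conj, Complex.norm_real, Real.norm_of_nonneg (by positivity)]
      rcases (norm_nonneg (u x)).eq_or_lt with h0 | h0
      · rw [← h0, zero_mul, Real.zero_rpow (by linarith)]
      · rw [mul_comm, ← Real.rpow_add_one h0.ne']
        ring_nf
    have huv : ∀ x, u x * v x = ((‖u x‖ ^ q : ℝ) : ℂ) := by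
      intro x
      rw [← mul_assoc, Complex.mul_conj, Complex.normSq_eq_norm_sq, ← Complex.ofReal_mul]
      congr 1
      rcases (norm_nonneg (u x)).eq_or_lt with h0 | h0
      · simp [← h0, hq0.ne']
      · rw [← Real.rpow_natCast, ← Real.rpow_add h0]
        congr 1
        push_cast
        ring
    obtain ⟨M, hM⟩ := hB.exists_bound_of_continuousOn hv.continuousOn
    have hmem : ∀ s : ℝ≥0∞, MemLp (B.indicator v) s μ := fun s =>
      (memLp_indicator_iff_restrict hBm).2 (MemLp.of_bound hv.aestronglyMeasurable M
        ((ae_restrict_iff' hBm).2 (Filter.Eventually.of_forall hM)))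
    have hφ := h (B.indicator v) (hv.measurable.indicator hBm)
      (memLp_one_iff_integrable.1 (hmem 1)) (hmem 2)
    have hcont : Continuous fun x => ‖u x‖ ^ q := hu.norm.rpow_const fun _ => Or.inr hq0.le
    have hofReal : ∀ x, ENNReal.ofReal (‖u x‖ ^ q) = ‖u x‖ₑ ^ q := fun x => by
      rw [← ofReal_norm, ENNReal.ofReal_rpow_of_nonneg (norm_nonneg _) hq0.le]
    set I := ∫⁻ x in B, ‖u x‖ₑ ^ q ∂μ with hI
    have hint : Integrable (fun x => ‖u x‖ ^ q) (μ.restrict B) :=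
      hcont.continuousOn.integrableOn_compact hB
    have hIr : ENNReal.ofReal (∫ x in B, ‖u x‖ ^ q ∂μ) = I := by
      rw [ofReal_integral_eq_lintegral_ofReal hint
        (Filter.Eventually.of_forall fun x => by positivity)]
      exact lintegral_congr hofReal
    have hItop : I ≠ ∞ := hIr ▸ ENNReal.ofReal_ne_top
    have e1 : ‖∫ x, u x * B.indicator v x ∂μ‖ₑ = I := by
      have : ∀ x, u x * B.indicator v x = B.indicator (fun x => ((‖u x‖ ^ q : ℝ) : ℂ)) x := by
        intro x
        by_cases hx : x ∈ B <;> simp [hx, huv]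
      simp_rw [this]
      rw [integral_indicator hBm, integral_complex_ofReal, ← ofReal_norm, Complex.norm_real,
        Real.norm_of_nonneg (integral_nonneg fun x => by positivity), hIr]
    have e2 : ∫⁻ x, ‖B.indicator v x‖ₑ ^ r ∂μ = I := by
      rw [hI, ← lintegral_indicator hBm]
      refine lintegral_congr fun x => ?_
      by_cases hx : x ∈ B
      · simp only [hx, Set.indicator_of_mem]
        rw [← ofReal_norm, hvn, ← hofReal, ENNReal.ofReal_rpow_of_nonneg (by positivity)
          hqr.symm.nonneg, ← Real.rpow_mul (norm_nonneg _), hqr.sub_one_mul_conj]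
      · simp [hx, hqr.symm.pos]
    rw [e1, e2] at hφ
    by_cases hI0 : I = 0
    · simp [hI0]
    have e3 : I ^ (1 / q) * I ^ (1 / r) = I := by
      rw [← ENNReal.rpow_add _ _ hI0 hItop, one_div, one_div, hqr.inv_add_inv_eq_one,
        ENNReal.rpow_one]
    have e4 : I ^ (1 / q) ≤ A := by
      refine (ENNReal.mul_le_mul_iff_left (c := I ^ (1 / r)) ?_ ?_).1 (e3.le.trans hφ)
      · simp [ENNReal.rpow_eq_zero_iff, hI0, hItop]
      · exact ENNReal.rpow_ne_top_of_nonneg (by have := hqr.symm.pos; positivity) hItop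
    calc I = (I ^ (1 / q)) ^ q := by
          rw [← ENNReal.rpow_mul, one_div_mul_cancel hq0.ne', ENNReal.rpow_one]
      _ ≤ A ^ q := by gcongr
  have hlim := (aecover_closedBall (μ := μ) (x := (0 : V))
    tendsto_natCast_atTop_atTop).lintegral_tendsto_of_nat
      (hu.measurable.enorm.pow_const q).aemeasurable
  have := le_of_tendsto' hlim key
  calc _ ≤ (A ^ q) ^ (1 / q) := by gcongr
    _ = A := by rw [← ENNReal.rpow_mul, mul_one_div_cancel hq0.ne', ENNReal.rpow_one]

theorem enorm_integral_fourierInv_mul_le {V : Type*} [NormedAddCommGroup V]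
    [InnerProductSpace ℝ V] [FiniteDimensional ℝ V] [MeasurableSpace V] [BorelSpace V]
    {h φ : V → ℂ} (hh : Integrable h) (hφ : Integrable φ) :
    ‖∫ x, 𝓕⁻ h x * φ x‖ₑ ≤ ∫⁻ ξ, ‖h ξ‖ₑ * ‖𝓕 φ (-ξ)‖ₑ := by
  have e : ∫ x, 𝓕⁻ h x * φ x = ∫ ξ, h ξ * 𝓕 φ (-ξ) := by
    have := VectorFourier.integral_bilin_fourierIntegral_eq_flip (.mul ℂ ℂ) (L := -innerₗ V)
      Real.continuous_fourierChar (continuous_inner (𝕜 := ℝ) (E := V)).neg hh hφ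
    simp_rw [← Real.fourierInv_eq_fourier_neg]
    have hflip : (-innerₗ V).flip = -innerₗ V := by
      ext x y
      simp [real_inner_comm]
    rw [hflip] at this
    exact this
  rw [e]
  refine (enorm_integral_le_lintegral_enorm _).trans (le_of_eq ?_)
  simp_rw [enorm_mul]

theorem lintegral_mul_le_of_sq_le {α : Type*} [MeasurableSpace α] {μ : Measure α}
    {f g : α → ℝ≥0∞} (hf : AEMeasurable f μ) (hg : AEMeasurable g μ) {a b : ℝ≥0∞}
    (ha : ∫⁻ x, f x ^ (2 : ℝ) ∂μ ≤ a ^ (2 : ℝ)) (hb : ∫⁻ x, g x ^ (2 : ℝ) ∂μ ≤ b ^ (2 : ℝ)) :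
    ∫⁻ x, f x * g x ∂μ ≤ a * b := by
  have hsqrt : ∀ c : ℝ≥0∞, (c ^ (2 : ℝ)) ^ (1 / 2 : ℝ) = c := fun c => by
    rw [← ENNReal.rpow_mul]
    norm_num
  calc ∫⁻ x, f x * g x ∂μ
      ≤ (∫⁻ x, f x ^ (2 : ℝ) ∂μ) ^ (1 / 2 : ℝ) * (∫⁻ x, g x ^ (2 : ℝ) ∂μ) ^ (1 / 2 : ℝ) :=
        ENNReal.lintegral_mul_le_Lp_mul_Lq μ Real.HolderConjugate.two_two hf hg
    _ ≤ (a ^ (2 : ℝ)) ^ (1 / 2 : ℝ) * (b ^ (2 : ℝ)) ^ (1 / 2 : ℝ) := by gcongr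
    _ = a * b := by rw [hsqrt, hsqrt]

theorem exists_lintegral_rpow_weight_fourier_sq_le {V : Type*} [NormedAddCommGroup V]
    [InnerProductSpace ℝ V] [FiniteDimensional ℝ V] [MeasurableSpace V] [BorelSpace V]
    [Nontrivial V] {p : ℝ} (hp1 : 1 < p) (hp2 : p ≤ 2) :
    ∃ C : ℝ≥0∞, C ≠ ∞ ∧ ∀ f : V → ℂ, Measurable f → Integrable f → MemLp f 2 →
      ∫⁻ ξ, (ENNReal.ofReal (‖ξ‖ ^ (-(Module.finrank ℝ V * (1 / p - 1 / 2)))) *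
        ‖𝓕 f ξ‖ₑ) ^ (2 : ℝ) ≤ (C * (∫⁻ x, ‖f x‖ₑ ^ p) ^ (1 / p)) ^ (2 : ℝ) := by
  obtain ⟨C, hC, h⟩ := exists_lintegral_weight_fourier_sq_le (V := V) hp1 hp2
  refine ⟨C ^ (1 / 2 : ℝ), by finiteness, fun f hfm hf1 hf2 => ?_⟩
  refine le_trans (le_of_eq (lintegral_congr fun ξ => ?_)) ((h f hfm hf1 hf2).trans (le_of_eq ?_))
  · rw [ENNReal.mul_rpow_of_nonneg _ _ (by norm_num), ENNReal.ofReal_rpow_of_nonneg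
      (by positivity) (by norm_num), ← Real.rpow_mul (norm_nonneg _)]
    congr 4
    ring
  · rw [ENNReal.mul_rpow_of_nonneg _ _ (by norm_num), ← ENNReal.rpow_mul, ← ENNReal.rpow_mul]
    norm_num
    congr 2
    ring

/-- Scalar `(L^p, L^q)` Fourier multiplier theorem: if `1 < p ≤ 2 ≤ q < ∞`
and `sup_{ξ ≠ 0} |ξ|^{n(1/p − 1/q)} |m ξ| ≤ K < ∞`, then `m` is a bounded `(L^p, L^q)`
Fourier multiplier on `ℝ^n`. -/
theorem scalar_LpLq_multiplier (n : ℕ) (hn : 1 ≤ n) (p q : ℝ)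
    (hp1 : 1 < p) (hp2 : p ≤ 2) (hq2 : 2 ≤ q)
    (m : EuclideanSpace ℝ (Fin n) → ℂ) (hm : Measurable m)
    (K : ℝ)
    (hK : ∀ ξ : EuclideanSpace ℝ (Fin n), ξ ≠ 0 →
      ‖ξ‖ ^ ((n : ℝ) * (1 / p - 1 / q)) * ‖m ξ‖ ≤ K) :
    ∃ C : ℝ, 0 ≤ C ∧ ∀ f : SchwartzMap (EuclideanSpace ℝ (Fin n)) ℂ,
      eLpNorm (𝓕⁻ (fun ξ => m ξ * 𝓕 (⇑f) ξ)) (ENNReal.ofReal q) volume ≤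
        ENNReal.ofReal C * eLpNorm (⇑f) (ENNReal.ofReal p) volume := by
  have : NeZero n := ⟨by omega⟩
  have hp0 : 0 < p := by linarith
  have hq0 : 0 < q := by linarith
  have hLp : ∀ (s : ℝ) (_ : 0 < s) (g : EuclideanSpace ℝ (Fin n) → ℂ),
      eLpNorm g (ENNReal.ofReal s) volume = (∫⁻ x, ‖g x‖ₑ ^ s) ^ (1 / s) := fun s hs g => by
    rw [eLpNorm_eq_lintegral_rpow_enorm_toReal (by simpa using hs) ENNReal.ofReal_ne_top,
      ENNReal.toReal_ofReal hs.le]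
  set r := q / (q - 1) with hr
  have hqr : q.HolderConjugate r := .conjExponent (by linarith)
  have hr1 : 1 < r := hqr.symm.lt
  have hr2 : r ≤ 2 := by
    rw [hr, div_le_iff₀ (by linarith)]
    linarith
  obtain ⟨C₁, hC₁, h₁⟩ := exists_lintegral_rpow_weight_fourier_sq_le
    (V := EuclideanSpace ℝ (Fin n)) hp1 hp2
  obtain ⟨C₂, hC₂, h₂⟩ := exists_lintegral_rpow_weight_fourier_sq_le
    (V := EuclideanSpace ℝ (Fin n)) hr1 hr2
  rw [finrank_euclideanSpace_fin] at h₁ h₂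
  refine ⟨(ENNReal.ofReal K * C₁ * C₂).toReal, ENNReal.toReal_nonneg, fun f => ?_⟩
  rw [ENNReal.ofReal_toReal (by finiteness), hLp q hq0, hLp p hp0]
  by_cases hint : Integrable fun ξ => m ξ * 𝓕 (⇑f) ξ
  swap
  · have h0 : ∀ x, 𝓕⁻ (fun ξ => m ξ * 𝓕 (⇑f) ξ) x = 0 := fun x => by
      rw [Real.fourierInv_eq_fourier_neg, Real.fourier_eq]
      exact integral_undef (by rwa [Real.fourierIntegral_convergent_iff])
    simp [h0, hq0]
  have hcont : Continuous (𝓕⁻ (fun ξ => m ξ * 𝓕 (⇑f) ξ)) := by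
    have := (continuous_fourier_of_integrable hint).comp continuous_neg
    rwa [show 𝓕⁻ (fun ξ => m ξ * 𝓕 (⇑f) ξ) = 𝓕 (fun ξ => m ξ * 𝓕 (⇑f) ξ) ∘ fun a => -a from
      funext (Real.fourierInv_eq_fourier_neg _)]
  refine lintegral_enorm_rpow_le_of_duality hqr hq2 hcont fun φ hφm hφ1 hφ2 => ?_
  refine (enorm_integral_fourierInv_mul_le hint hφ1).trans ?_
  set N := (∫⁻ x, ‖f x‖ₑ ^ p) ^ (1 / p)
  set M := (∫⁻ x, ‖φ x‖ₑ ^ r) ^ (1 / r)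
  let F : EuclideanSpace ℝ (Fin n) → ℝ≥0∞ := fun ξ =>
    ENNReal.ofReal (‖ξ‖ ^ (-(n * (1 / p - 1 / 2)))) * ‖𝓕 (⇑f) ξ‖ₑ
  let G : EuclideanSpace ℝ (Fin n) → ℝ≥0∞ := fun ξ =>
    ENNReal.ofReal (‖ξ‖ ^ (-(n * (1 / r - 1 / 2)))) * ‖𝓕 φ ξ‖ₑ
  have hFm : Measurable F := (measurable_norm.pow_const _).ennreal_ofReal.mul
    (continuous_fourier_of_integrable f.integrable).measurable.enorm
  have hGm : Measurable G := (measurable_norm.pow_const _).ennreal_ofReal.mul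
    (continuous_fourier_of_integrable hφ1).measurable.enorm
  have hF : ∫⁻ ξ, F ξ ^ (2 : ℝ) ≤ (C₁ * N) ^ (2 : ℝ) :=
    h₁ f f.continuous.measurable f.integrable (f.memLp 2)
  have hG : ∫⁻ ξ, G (-ξ) ^ (2 : ℝ) ≤ (C₂ * M) ^ (2 : ℝ) := by
    rw [lintegral_neg_eq_self fun ξ => G ξ ^ (2 : ℝ)]
    exact h₂ φ hφm hφ1 hφ2
  have hpt : ∀ ξ, ξ ≠ 0 →
      ‖m ξ * 𝓕 (⇑f) ξ‖ₑ * ‖𝓕 φ (-ξ)‖ₑ ≤ ENNReal.ofReal K * (F ξ * G (-ξ)) := by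
    intro ξ hξ
    have h0 : 0 < ‖ξ‖ := norm_pos_iff.2 hξ
    have hmξ : ‖m ξ‖ ≤ K * (‖ξ‖ ^ (-(n * (1 / p - 1 / 2))) * ‖ξ‖ ^ (-(n * (1 / r - 1 / 2)))) := by
      have hexp : -(n * (1 / p - 1 / 2)) + -(n * (1 / r - 1 / 2)) =
          -((n : ℝ) * (1 / p - 1 / q)) := by
        have := hqr.inv_add_inv_eq_one
        rw [one_div, one_div, one_div, one_div, eq_sub_iff_add_eq'.2 this]
        ring
      rw [← Real.rpow_add h0, hexp, Real.rpow_neg h0.le, ← div_eq_mul_inv,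
        le_div_iff₀ (by positivity), mul_comm]
      exact hK ξ hξ
    have hK0 : 0 ≤ K := le_trans (by positivity) (hK ξ hξ)
    have hme : ‖m ξ‖ₑ ≤ ENNReal.ofReal K * (ENNReal.ofReal (‖ξ‖ ^ (-(n * (1 / p - 1 / 2)))) *
        ENNReal.ofReal (‖ξ‖ ^ (-(n * (1 / r - 1 / 2))))) := by
      rw [← ofReal_norm, ← ENNReal.ofReal_mul (by positivity), ← ENNReal.ofReal_mul hK0]
      exact ENNReal.ofReal_le_ofReal hmξ
    simp only [F, G, norm_neg, enorm_mul]
    calc _ ≤ (ENNReal.ofReal K * (ENNReal.ofReal (‖ξ‖ ^ (-(n * (1 / p - 1 / 2)))) *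
        ENNReal.ofReal (‖ξ‖ ^ (-(n * (1 / r - 1 / 2)))))) * ‖𝓕 (⇑f) ξ‖ₑ * ‖𝓕 φ (-ξ)‖ₑ := by gcongr
      _ = _ := by ring
  calc ∫⁻ ξ, ‖m ξ * 𝓕 (⇑f) ξ‖ₑ * ‖𝓕 φ (-ξ)‖ₑ
      ≤ ∫⁻ ξ, ENNReal.ofReal K * (F ξ * G (-ξ)) :=
        lintegral_mono_ae ((Measure.ae_ne volume 0).mono hpt)
    _ = ENNReal.ofReal K * ∫⁻ ξ, F ξ * G (-ξ) :=
        lintegral_const_mul _ (hFm.mul (hGm.comp measurable_neg))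
    _ ≤ ENNReal.ofReal K * (C₁ * N * (C₂ * M)) := by
        gcongr
        exact lintegral_mul_le_of_sq_le hFm.aemeasurable
          (hGm.comp measurable_neg).aemeasurable hF hG
    _ = ENNReal.ofReal K * C₁ * C₂ * N * M := by ring
end

section
/- Let X and Y be complex Banach spaces, p ∈ [1,2] and q ∈ [2,∞] with p ≤ q, and let 1/r = 1/p − 1/q. Assume X has Fourier type p with constant C_X, i.e. ‖𝓕 f‖_{L^{p'}(ℝ^n;X)} ≤ C_X ‖f‖_{L^p(ℝ^n;X)} for every X-valued Schwartz function f (where 1/p + 1/p' = 1), and assume Y has Fourier type q' with constant C_Y, i.e. ‖𝓕 g‖_{L^{q}(ℝ^n;Y)} ≤ C_Y ‖g‖_{L^{q'}(ℝ^n;Y)} for every Y-valued Schwartz function g. Let m : ℝ^n → L(X,Y) be strongly measurable with ξ ↦ ‖m(ξ)‖_{L(X,Y)} in L^r(ℝ^n). Then m is a bounded (L^p, L^q) Fourier multiplier: ‖𝓕⁻¹(m · 𝓕 f)‖_{L^q(ℝ^n;Y)} ≤ C_X C_Y ‖ ‖m(·)‖ ‖_{L^r(ℝ^n)} ‖f‖_{L^p(ℝ^n;X)}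 for every X-valued Schwartz function f. -/
open MeasureTheory FourierTransform SchwartzMap ENNReal

/-- The tail of an `L^p` function outside large closed balls is small. -/
theorem exists_eLpNorm_indicator_compl_closedBall_le {V E : Type*} [NormedAddCommGroup V]
    [NormedSpace ℝ V] [FiniteDimensional ℝ V] [MeasurableSpace V] [BorelSpace V]
    [NormedAddCommGroup E] [NormedSpace ℝ E] {μ : Measure V} [IsFiniteMeasureOnCompacts μ]
    {p : ℝ≥0∞} (hp : p ≠ ⊤) (hp1 : 1 ≤ p) {h : V → E} (hh : MemLp h p μ) {ε : ℝ} (hε : 0 < ε) :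
    ∃ R : ℝ, ∀ R' ≥ R,
      eLpNorm ((Metric.closedBall (0 : V) R')ᶜ.indicator h) p μ ≤ ENNReal.ofReal ε := by
  obtain ⟨g, hg, -, hhg⟩ := MemLp.exist_eLpNorm_sub_le hp hp1 hh hε
  obtain ⟨R, hR⟩ := hg.isCompact.isBounded.subset_closedBall (0 : V)
  refine ⟨R, fun R' hR' => (eLpNorm_mono fun x => ?_).trans hhg⟩
  by_cases hx : x ∈ Metric.closedBall (0 : V) R'
  · simp [hx]
  · have hgx : g x = 0 := image_eq_zero_of_notMem_tsupport
      fun hx' => hx (Metric.closedBall_subset_closedBall hR' (hR hx'))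
    simp [Set.indicator_of_mem (show x ∈ (Metric.closedBall (0 : V) R')ᶜ from hx), hgx]

/-- A function supported in a ball can be approximated by Schwartz functions simultaneously in
`L^1` and `L^p`. -/
theorem exists_schwartzMap_eLpNorm_sub_le_of_closedBall {V E : Type*} [NormedAddCommGroup V]
    [InnerProductSpace ℝ V] [FiniteDimensional ℝ V] [MeasurableSpace V] [BorelSpace V]
    [NormedAddCommGroup E] [NormedSpace ℝ E] {μ : Measure V} [IsFiniteMeasureOnCompacts μ]
    {p : ℝ≥0∞} (hp : p ≠ ⊤) (hp1 : 1 ≤ p) {h : V → E} (hh : MemLp h p μ) {R : ℝ} (hR : 0 < R)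
    (hsupp : ∀ x ∉ Metric.closedBall (0 : V) R, h x = 0) {ε : ℝ} (hε : 0 < ε) :
    ∃ g : 𝓢(V, E), eLpNorm (h - ⇑g) 1 μ ≤ ENNReal.ofReal ε ∧
      eLpNorm (h - ⇑g) p μ ≤ ENNReal.ofReal ε := by
  set B := Metric.closedBall (0 : V) (R + 1) with hB
  set K : ℝ≥0∞ := μ B ^ (1 - 1 / p.toReal) with hK
  have hp0 : 1 ≤ p.toReal := by
    simpa using ENNReal.toReal_mono hp hp1
  have hKtop : K ≠ ⊤ := by
    refine ENNReal.rpow_ne_top_of_nonneg ?_ (isCompact_closedBall _ _).measure_lt_top.ne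
    rw [sub_nonneg, div_le_one (by linarith)]
    exact hp0
  set δ : ℝ := ε / (K.toReal + 1) with hδ
  have hK0 : 0 ≤ K.toReal := ENNReal.toReal_nonneg
  have hδ0 : 0 < δ := by positivity
  have hδε : δ ≤ ε := div_le_self hε.le (by linarith)
  have hδK : δ * K.toReal ≤ ε := by
    rw [hδ, div_mul_eq_mul_div, div_le_iff₀ (by positivity)]
    nlinarith
  obtain ⟨g, hgc, hgs, hhg⟩ := MemLp.exist_eLpNorm_sub_le hp hp1 hh hδ0
  let χ : ContDiffBump (0 : V) := ⟨R, R + 1, hR, by linarith⟩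
  have hχc : HasCompactSupport (fun x => χ x • g x) := hgc.smul_left
  have hχs : ContDiff ℝ (⊤ : ℕ∞) (fun x => χ x • g x) := χ.contDiff.smul hgs
  refine ⟨hχc.toSchwartzMap hχs, ?_⟩
  have hform : h - ⇑(hχc.toSchwartzMap hχs) = fun x => χ x • (h - g) x := by
    ext x
    by_cases hx : x ∈ Metric.closedBall (0 : V) R
    · simp [χ.one_of_mem_closedBall hx]
    · simp [hsupp x hx]
  have hbd : eLpNorm (fun x => χ x • (h - g) x) p μ ≤ ENNReal.ofReal δ := by
    refine (eLpNorm_mono fun x => ?_).trans hhg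
    rw [norm_smul, Real.norm_of_nonneg χ.nonneg]
    exact mul_le_of_le_one_left (norm_nonneg _) χ.le_one
  rw [hform]
  refine ⟨?_, hbd.trans (ENNReal.ofReal_le_ofReal hδε)⟩
  have hmeas : AEStronglyMeasurable (fun x => χ x • (h - g) x) μ :=
    χ.continuous.aestronglyMeasurable.smul
      (hh.1.sub hgs.continuous.aestronglyMeasurable)
  have hind : B.indicator (fun x => χ x • (h - g) x) = fun x => χ x • (h - g) x := by
    refine Set.indicator_eq_self.2 fun x hx => ?_
    by_contra hxB
    refine hx ?_
    have : χ x = 0 := χ.zero_of_le_dist (by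
      simp only [hB, Metric.mem_closedBall, not_le] at hxB
      exact hxB.le)
    simp [this]
  calc eLpNorm (fun x => χ x • (h - g) x) 1 μ
      = eLpNorm (fun x => χ x • (h - g) x) 1 (μ.restrict B) := by
        rw [← eLpNorm_indicator_eq_eLpNorm_restrict Metric.isClosed_closedBall.measurableSet, hind]
    _ ≤ eLpNorm (fun x => χ x • (h - g) x) p (μ.restrict B) * K := by
        simpa [hK] using eLpNorm_le_eLpNorm_mul_rpow_measure_univ hp1 hmeas.restrict
    _ ≤ ENNReal.ofReal δ * K := by
        gcongr
        exact (eLpNorm_restrict_le _ _ _ _).trans hbd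
    _ = ENNReal.ofReal (δ * K.toReal) := by
        rw [ENNReal.ofReal_mul hδ0.le, ENNReal.ofReal_toReal hKtop]
    _ ≤ ENNReal.ofReal ε := ENNReal.ofReal_le_ofReal hδK

/-- Schwartz functions are dense in `L^1 ∩ L^p`. -/
theorem exists_schwartzMap_eLpNorm_sub_le {V E : Type*} [NormedAddCommGroup V]
    [InnerProductSpace ℝ V] [FiniteDimensional ℝ V] [MeasurableSpace V] [BorelSpace V]
    [NormedAddCommGroup E] [NormedSpace ℝ E] {μ : Measure V} [IsFiniteMeasureOnCompacts μ]
    {p : ℝ≥0∞} (hp : p ≠ ⊤) (hp1 : 1 ≤ p) {h : V → E} (h1 : MemLp h 1 μ) (hh : MemLp h p μ)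
    {ε : ℝ} (hε : 0 < ε) :
    ∃ g : 𝓢(V, E), eLpNorm (h - ⇑g) 1 μ ≤ ENNReal.ofReal ε ∧
      eLpNorm (h - ⇑g) p μ ≤ ENNReal.ofReal ε := by
  have hε' : 0 < ε / 2 := half_pos hε
  obtain ⟨R₁, hR₁⟩ := exists_eLpNorm_indicator_compl_closedBall_le (μ := μ) (h := h)
    one_ne_top le_rfl h1 hε'
  obtain ⟨R₂, hR₂⟩ := exists_eLpNorm_indicator_compl_closedBall_le (μ := μ) (h := h)
    hp hp1 hh hε'
  set R : ℝ := max 1 (max R₁ R₂)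
  set B := Metric.closedBall (0 : V) R
  have hBm : MeasurableSet B := Metric.isClosed_closedBall.measurableSet
  have hR : 0 < R := lt_of_lt_of_le one_pos (le_max_left _ _)
  obtain ⟨g, hg1, hgp⟩ := exists_schwartzMap_eLpNorm_sub_le_of_closedBall (h := B.indicator h)
    hp hp1 (hh.indicator hBm) hR (fun x hx => Set.indicator_of_notMem hx h) hε'
  have hsplit : h - ⇑g = Bᶜ.indicator h + (B.indicator h - ⇑g) := by
    rw [← add_sub_assoc, Set.indicator_compl_add_self]
  have hgm : AEStronglyMeasurable (B.indicator h - ⇑g) μ :=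
    (hh.1.indicator hBm).sub g.continuous.aestronglyMeasurable
  have hε2 : ENNReal.ofReal (ε / 2) + ENNReal.ofReal (ε / 2) = ENNReal.ofReal ε := by
    rw [← ENNReal.ofReal_add hε'.le hε'.le, add_halves]
  refine ⟨g, ?_, ?_⟩ <;> rw [hsplit, ← hε2]
  · exact (eLpNorm_add_le (hh.1.indicator hBm.compl) hgm le_rfl).trans
      (add_le_add (hR₁ R ((le_max_left _ _).trans (le_max_right _ _))) hg1)
  · exact (eLpNorm_add_le (hh.1.indicator hBm.compl) hgm hp1).trans
      (add_le_add (hR₂ R ((le_max_right _ _).trans (le_max_right _ _))) hgp)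

/-- The `L^q` seminorms of the Fourier transform and its inverse agree on Schwartz functions. -/
theorem SchwartzMap.eLpNorm_fourierInv_eq {V E : Type*} [NormedAddCommGroup V]
    [InnerProductSpace ℝ V] [FiniteDimensional ℝ V] [MeasurableSpace V] [BorelSpace V]
    [NormedAddCommGroup E] [NormedSpace ℂ E] [CompleteSpace E] (g : 𝓢(V, E)) (q : ℝ≥0∞) :
    eLpNorm (𝓕⁻ (⇑g)) q volume = eLpNorm (𝓕 (⇑g)) q volume := by
  have hneg : 𝓕⁻ (⇑g) = 𝓕 (⇑g) ∘ Neg.neg := funext (Real.fourierInv_eq_fourier_neg _)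
  rw [hneg, eLpNorm_comp_measurePreserving _ (Measure.measurePreserving_neg volume)]
  rw [← SchwartzMap.fourier_coe]
  exact (𝓕 g).continuous.aestronglyMeasurable

/-- An `(L^p, L^q)` bound for the Fourier transform on Schwartz functions extends to a bound for the
inverse Fourier integral on `L^1 ∩ L^p`. -/
theorem eLpNorm_fourierInv_le {V E : Type*} [NormedAddCommGroup V]
    [InnerProductSpace ℝ V] [FiniteDimensional ℝ V] [MeasurableSpace V] [BorelSpace V]
    [NormedAddCommGroup E] [NormedSpace ℂ E] [CompleteSpace E] {p q : ℝ≥0∞} (hp : p ≠ ⊤)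
    (hp1 : 1 ≤ p) {C : ℝ≥0∞} (hC : C ≠ ⊤)
    (hE : ∀ g : 𝓢(V, E), eLpNorm (𝓕 (⇑g)) q volume ≤ C * eLpNorm (⇑g) p volume)
    {h : V → E} (h1 : Integrable h) (hh : MemLp h p volume) :
    eLpNorm (𝓕⁻ h) q volume ≤ C * eLpNorm h p volume := by
  have hex (k : ℕ) := exists_schwartzMap_eLpNorm_sub_le hp hp1 (memLp_one_iff_integrable.2 h1) hh
    (Nat.one_div_pos_of_nat (α := ℝ) (n := k))
  choose g hg1 hgp using hex
  have hε : Filter.Tendsto (fun k : ℕ => ENNReal.ofReal (1 / ((k : ℝ) + 1))) Filter.atTop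
      (nhds 0) := by
    simpa using ENNReal.tendsto_ofReal (tendsto_one_div_add_atTop_nhds_zero_nat (𝕜 := ℝ))
  have hlim (x : V) : Filter.Tendsto (fun k => 𝓕⁻ (⇑(g k)) x) Filter.atTop (nhds (𝓕⁻ h x)) := by
    simp only [Real.fourierInv_eq]
    have hint {u : V → E} (hu : Integrable u) :
        Integrable (fun v => Real.fourierChar (inner ℝ v x) • u v) := by
      have := (Real.fourierIntegral_convergent_iff (μ := volume) (f := u) (-x)).2 hu
      simpa using this
    refine tendsto_integral_of_L1' _ (hint h1).1 (.of_forall fun k => hint (g k).integrable) ?_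
    refine tendsto_of_tendsto_of_tendsto_of_le_of_le tendsto_const_nhds hε
      (fun _ => zero_le) fun k => le_trans (eLpNorm_mono fun v => ?_) (hg1 k)
    simp [← smul_sub, Circle.norm_smul, norm_sub_rev]
  have hnorm (k : ℕ) : eLpNorm (𝓕⁻ (⇑(g k))) q volume ≤
      C * (eLpNorm h p volume + ENNReal.ofReal (1 / ((k : ℝ) + 1))) := by
    rw [SchwartzMap.eLpNorm_fourierInv_eq]
    refine (hE (g k)).trans (mul_le_mul_right ?_ C)
    have hgk : ⇑(g k) = h - (h - ⇑(g k)) := (_root_.sub_sub_cancel _ _).symm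
    calc eLpNorm (⇑(g k)) p volume = eLpNorm (h - (h - ⇑(g k))) p volume := by rw [← hgk]
      _ ≤ eLpNorm h p volume + eLpNorm (h - ⇑(g k)) p volume :=
        eLpNorm_sub_le hh.1 (hh.1.sub (g k).continuous.aestronglyMeasurable) hp1
      _ ≤ _ := by gcongr; exact hgp k
  have hmeas (k : ℕ) : AEStronglyMeasurable (𝓕⁻ (⇑(g k))) volume := by
    rw [← SchwartzMap.fourierInv_coe]
    exact (𝓕⁻ (g k)).continuous.aestronglyMeasurable
  have hup : Filter.Tendsto (fun k : ℕ => C * (eLpNorm h p volume +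
      ENNReal.ofReal (1 / ((k : ℝ) + 1)))) Filter.atTop (nhds (C * eLpNorm h p volume)) := by
    have := ENNReal.Tendsto.const_mul (hε.const_add (eLpNorm h p volume)) (.inr hC)
    simpa using this
  calc eLpNorm (𝓕⁻ h) q volume
      ≤ Filter.atTop.liminf fun k => eLpNorm (𝓕⁻ (⇑(g k))) q volume :=
        Lp.eLpNorm_lim_le_liminf_eLpNorm hmeas _ (.of_forall hlim)
    _ ≤ Filter.atTop.liminf fun k : ℕ =>
        C * (eLpNorm h p volume + ENNReal.ofReal (1 / ((k : ℝ) + 1))) :=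
        Filter.liminf_le_liminf (.of_forall hnorm)
    _ = C * eLpNorm h p volume := hup.liminf_eq

/-- Pointwise application of a strongly measurable operator family to a continuous function is
strongly measurable. -/
theorem stronglyMeasurable_clm_apply_of_continuous {V X Y : Type*} [TopologicalSpace V]
    [TopologicalSpace.MetrizableSpace V] [SecondCountableTopology V] [MeasurableSpace V]
    [OpensMeasurableSpace V] [NormedAddCommGroup X] [NormedSpace ℂ X] [NormedAddCommGroup Y]
    [NormedSpace ℂ Y] {m : V → (X →L[ℂ] Y)} (hm : ∀ x : X, StronglyMeasurable (fun ξ => m ξ x))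
    {g : V → X} (hg : Continuous g) : StronglyMeasurable (fun ξ => m ξ (g ξ)) :=
  (stronglyMeasurable_uncurry_of_continuous_of_stronglyMeasurable
    (u := fun η ξ => m ξ (g η)) (fun ξ => (m ξ).continuous.comp hg)
    (fun η => hm (g η))).comp_measurable (measurable_id.prodMk measurable_id)

/-- The norm of a strongly measurable operator family need not be measurable, but along a
continuous function it can be replaced by a measurable minorant. -/
theorem exists_measurable_le_norm_clm {V X Y : Type*} [TopologicalSpace V]
    [SecondCountableTopology V] [Nonempty V] [MeasurableSpace V] [NormedAddCommGroup X]
    [NormedSpace ℂ X] [NormedAddCommGroup Y] [NormedSpace ℂ Y] {m : V → (X →L[ℂ] Y)}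
    (hm : ∀ x : X, StronglyMeasurable (fun ξ => m ξ x)) {g : V → X} (hg : Continuous g) :
    ∃ N : V → ℝ, Measurable N ∧ (∀ ξ, 0 ≤ N ξ) ∧ (∀ ξ, N ξ ≤ ‖m ξ‖) ∧
      ∀ ξ, ‖m ξ (g ξ)‖ ≤ N ξ * ‖g ξ‖ := by
  obtain ⟨d, hd⟩ := TopologicalSpace.exists_dense_seq V
  have hle (ξ : V) (j : ℕ) : ‖m ξ (g (d j))‖ / ‖g (d j)‖ ≤ ‖m ξ‖ :=
    (m ξ).ratio_le_opNorm _
  have hbdd (ξ : V) : BddAbove (Set.range fun j => ‖m ξ (g (d j))‖ / ‖g (d j)‖) :=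
    ⟨‖m ξ‖, Set.forall_mem_range.2 (hle ξ)⟩
  refine ⟨fun ξ => ⨆ j, ‖m ξ (g (d j))‖ / ‖g (d j)‖,
    Measurable.iSup fun j => (hm (g (d j))).norm.measurable.div_const _,
    fun ξ => Real.iSup_nonneg fun j => by positivity, fun ξ => ciSup_le (hle ξ), fun ξ => ?_⟩
  have hclosed : IsClosed {η : V | ‖m ξ (g η)‖ ≤
      (⨆ j, ‖m ξ (g (d j))‖ / ‖g (d j)‖) * ‖g η‖} :=
    isClosed_le ((m ξ).continuous.comp hg).norm (continuous_const.mul hg.norm)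
  refine hd.induction_on (p := fun η => ‖m ξ (g η)‖ ≤
    (⨆ j, ‖m ξ (g (d j))‖ / ‖g (d j)‖) * ‖g η‖) ξ hclosed fun j => ?_
  rcases eq_or_ne (g (d j)) 0 with h0 | h0
  · simp [h0]
  · rw [← div_le_iff₀ (norm_pos_iff.2 h0)]
    exact le_ciSup (hbdd ξ) j

/-- Hölder's inequality for a strongly measurable operator family applied to a continuous
function. -/
theorem eLpNorm_clm_apply_le {V X Y : Type*} [TopologicalSpace V]
    [TopologicalSpace.MetrizableSpace V] [SecondCountableTopology V] [Nonempty V]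
    [MeasurableSpace V] [OpensMeasurableSpace V] [NormedAddCommGroup X]
    [NormedSpace ℂ X] [NormedAddCommGroup Y] [NormedSpace ℂ Y] {μ : Measure V}
    {m : V → (X →L[ℂ] Y)} (hm : ∀ x : X, StronglyMeasurable (fun ξ => m ξ x))
    {g : V → X} (hg : Continuous g) (r s t : ℝ≥0∞) [HolderTriple r s t] :
    eLpNorm (fun ξ => m ξ (g ξ)) t μ ≤ eLpNorm (fun ξ => ‖m ξ‖) r μ * eLpNorm g s μ := by
  obtain ⟨N, hN, hN0, hNle, hNg⟩ := exists_measurable_le_norm_clm hm hg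
  calc eLpNorm (fun ξ => m ξ (g ξ)) t μ ≤ eLpNorm (fun ξ => N ξ * ‖g ξ‖) t μ :=
        eLpNorm_mono_real hNg
    _ ≤ (1 : NNReal) * eLpNorm N r μ * eLpNorm (fun ξ => ‖g ξ‖) s μ :=
        eLpNorm_le_eLpNorm_mul_eLpNorm'_of_norm hN.aestronglyMeasurable
          hg.norm.aestronglyMeasurable (fun a b => a * b) 1 (.of_forall fun ξ => by simp)
    _ ≤ eLpNorm (fun ξ => ‖m ξ‖) r μ * eLpNorm g s μ := by
        rw [eLpNorm_norm, ENNReal.coe_one, one_mul]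
        gcongr
        refine eLpNorm_mono_real fun ξ => ?_
        rw [Real.norm_of_nonneg (hN0 ξ)]
        exact hNle ξ

/-- If `X` has Fourier type `p` with constant `C_X`, `Y` has Fourier type `q'`
with constant `C_Y`, `1 ≤ p ≤ 2 ≤ q ≤ ∞`, `1/r = 1/p − 1/q`, and `ξ ↦ ‖m ξ‖ ∈ L^r`, then `m`
is a bounded `(L^p, L^q)` Fourier multiplier with constant `C_X C_Y ‖‖m(·)‖‖_{L^r}`. -/
theorem fourier_type_LpLq_multiplier (n : ℕ)
    {X Y : Type*} [NormedAddCommGroup X] [NormedSpace ℂ X] [CompleteSpace X]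
    [NormedAddCommGroup Y] [NormedSpace ℂ Y] [CompleteSpace Y]
    (p q p' q' r : ℝ≥0∞) (hp1 : 1 ≤ p) (hp2 : p ≤ 2) (hq2 : 2 ≤ q)
    (hpq : p ≤ q)
    (hp' : 1 / p + 1 / p' = 1) (hq' : 1 / q + 1 / q' = 1)
    (hr : 1 / r = 1 / p - 1 / q)
    (C_X C_Y : ℝ) (hCX : 0 ≤ C_X) (hCY : 0 ≤ C_Y)
    -- X has Fourier type p with constant C_X:
    (hX : ∀ f : SchwartzMap (EuclideanSpace ℝ (Fin n)) X,
      eLpNorm (𝓕 (⇑f)) p' volume ≤ ENNReal.ofReal C_X * eLpNorm (⇑f) p volume)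
    -- Y has Fourier type q' with constant C_Y:
    (hY : ∀ g : SchwartzMap (EuclideanSpace ℝ (Fin n)) Y,
      eLpNorm (𝓕 (⇑g)) q volume ≤ ENNReal.ofReal C_Y * eLpNorm (⇑g) q' volume)
    (m : EuclideanSpace ℝ (Fin n) → (X →L[ℂ] Y))
    (hm : ∀ x : X, StronglyMeasurable (fun ξ => m ξ x))
    (hmr : eLpNorm (fun ξ => ‖m ξ‖) r volume < ⊤) :
    ∀ f : SchwartzMap (EuclideanSpace ℝ (Fin n)) X,
      eLpNorm (𝓕⁻ (fun ξ => m ξ (𝓕 (⇑f) ξ))) q volume ≤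
        ENNReal.ofReal C_X * ENNReal.ofReal C_Y *
          eLpNorm (fun ξ => ‖m ξ‖) r volume * eLpNorm (⇑f) p volume := by
  intro f
  simp only [one_div] at hp' hq' hr
  have hg : Continuous (𝓕 (⇑f)) := by
    rw [← SchwartzMap.fourier_coe]
    exact (𝓕 f).continuous
  have hp0 : p⁻¹ ≠ ⊤ := ENNReal.inv_ne_top.2 (one_pos.trans_le hp1).ne'
  have hq0 : q⁻¹ ≠ ⊤ := ENNReal.inv_ne_top.2 (two_pos.trans_le hq2).ne'
  have hrpq : r⁻¹ + q⁻¹ = p⁻¹ := by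
    rw [hr, tsub_add_cancel_of_le (ENNReal.inv_le_inv.2 hpq)]
  have hrq' : r⁻¹ + p'⁻¹ = q'⁻¹ := by
    refine (ENNReal.add_right_inj hq0).1 ?_
    rw [hq', ← hp', ← hrpq]
    ring
  have : HolderTriple r p' q' := ⟨hrq'⟩
  have hr1 : 1 ≤ r := by
    rw [← ENNReal.inv_le_inv, inv_one]
    exact (hrpq ▸ le_self_add : r⁻¹ ≤ p⁻¹).trans (ENNReal.inv_le_one.2 hp1)
  have : HolderTriple r (1 - r⁻¹)⁻¹ 1 := ⟨by
    rw [inv_inv, inv_one, add_tsub_cancel_of_le (ENNReal.inv_le_one.2 hr1)]⟩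
  have hq'1 : 1 ≤ q' := by
    rw [← ENNReal.inv_le_inv, inv_one, ← hq']
    exact le_add_self
  have hq'top : q' ≠ ⊤ := by
    rintro rfl
    have h2 : q⁻¹ ≤ 2⁻¹ := ENNReal.inv_le_inv.2 hq2
    rw [ENNReal.inv_top, add_zero] at hq'
    rw [hq'] at h2
    exact absurd h2 (not_le.2 (ENNReal.inv_lt_one.2 ENNReal.one_lt_two))
  have hmeas : AEStronglyMeasurable (fun ξ => m ξ (𝓕 (⇑f) ξ)) volume :=
    (stronglyMeasurable_clm_apply_of_continuous hm hg).aestronglyMeasurable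
  have hmem (s : ℝ≥0∞) : eLpNorm (𝓕 (⇑f)) s volume < ⊤ := by
    rw [← SchwartzMap.fourier_coe]
    exact ((𝓕 f).memLp s volume).2
  have h1 : Integrable (fun ξ => m ξ (𝓕 (⇑f) ξ)) :=
    memLp_one_iff_integrable.1 ⟨hmeas, (eLpNorm_clm_apply_le hm hg r (1 - r⁻¹)⁻¹ 1).trans_lt
      (ENNReal.mul_lt_top hmr (hmem _))⟩
  have hq'le := eLpNorm_clm_apply_le (μ := volume) hm hg r p' q'
  calc eLpNorm (𝓕⁻ (fun ξ => m ξ (𝓕 (⇑f) ξ))) q volume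
      ≤ ENNReal.ofReal C_Y * eLpNorm (fun ξ => m ξ (𝓕 (⇑f) ξ)) q' volume :=
        eLpNorm_fourierInv_le hq'top hq'1 ENNReal.ofReal_ne_top hY h1
          ⟨hmeas, hq'le.trans_lt (ENNReal.mul_lt_top hmr (hmem _))⟩
    _ ≤ ENNReal.ofReal C_Y * (eLpNorm (fun ξ => ‖m ξ‖) r volume *
          (ENNReal.ofReal C_X * eLpNorm (⇑f) p volume)) := by
        exact mul_le_mul_right (hq'le.trans (mul_le_mul_right (hX f) _)) _
    _ = _ := by ring
end
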